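/- arXiv:2104.00110 — 2 statements merged into one kernel-verified Lean document; each statement's English description precedes it below -/
import Mathlib

section
/- Let f be a topologically transitive expanding Lorenz map with critical point c. For x ∈ [0,1] define the generalized backward orbit B(x) = {y ∈ [0,1] : ∃k ≥ 0 and points y = y_0, y_1, …, y_k = x such that for each 0 ≤ i < k, y_{i+1} = f(y_i) if y_i ≠ c, and y_{i+1} ∈ {0,1} if y_i = c}. Then for every x ∈ [0,1] the set B(x) is dense in [0,1]. -/
open Set Filter Topology Function

/-- `f` is an expanding Lorenz map on `[a,b]` with critical point `c`:
continuous and strictly increasing on `[a,c)` and `(c,b]`, with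
`lim_{x→c⁻} f(x) = b`, `lim_{x→c⁺} f(x) = a`, and differentiable with
derivative uniformly greater than `1` outside a finite set. -/
structure IsExpandingLorenzOn (f : ℝ → ℝ) (c a b : ℝ) : Prop where
  a_lt_c : a < c
  c_lt_b : c < b
  mapsTo : Set.MapsTo f (Set.Icc a b) (Set.Icc a b)
  mono_left : StrictMonoOn f (Set.Ico a c)
  mono_right : StrictMonoOn f (Set.Ioc c b)
  cont_left : ContinuousOn f (Set.Ico a c)
  cont_right : ContinuousOn f (Set.Ioc c b)
  lim_left : Filter.Tendsto f (nhdsWithin c (Set.Iio c)) (nhds b)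
  lim_right : Filter.Tendsto f (nhdsWithin c (Set.Ioi c)) (nhds a)
  expanding : ∃ F : Set ℝ, F.Finite ∧ ∃ lam : ℝ, 1 < lam ∧
    ∀ x ∈ Set.Icc a b \ F, ∃ d : ℝ, HasDerivWithinAt f d (Set.Icc a b) x ∧ lam ≤ d

/-- An expanding Lorenz map on `[0,1]` with critical point `c`. -/
def IsExpandingLorenz (f : ℝ → ℝ) (c : ℝ) : Prop := IsExpandingLorenzOn f c 0 1

/-- A primary `n(k)`-cycle `z 0 < z 1 < ⋯ < z (n-k-1) < c < z (n-k) < ⋯ < z (n-1)`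
for a Lorenz map `f` with critical point `c`. -/
structure IsPrimaryCycle (f : ℝ → ℝ) (c : ℝ) (n k : ℕ) (z : ℕ → ℝ) : Prop where
  k_pos : 0 < k
  k_lt_n : k < n
  coprime : Nat.Coprime n k
  mem : ∀ i < n, z i ∈ Set.Icc (0:ℝ) 1
  mono : ∀ i j : ℕ, i < j → j < n → z i < z j
  left_of_c : ∀ i < n - k, z i < c
  right_of_c : ∀ i : ℕ, n - k ≤ i → i < n → c < z i
  step : ∀ i < n, f (z i) = z ((i + k) % n)
  le_f0 : z (k - 1) ≤ f 0
  f1_le : f 1 ≤ z k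

/-- `g` is a renormalization `(f^l, f^r)` of the Lorenz map `f` on the
renormalization interval `[u,v]`: on `[u,c)` (resp. `(c,v]`) the map `g`
is given by `f^[l]` (resp. `f^[r]`), with values given by one-sided limits
at points where some earlier iterate hits `c`, and `g` is itself an
expanding Lorenz map on `[u,v]` with critical point `c`. -/
structure IsRenormalization (f : ℝ → ℝ) (c : ℝ) (l r : ℕ) (u v : ℝ) (g : ℝ → ℝ) : Prop where
  one_lt_l : 1 < l
  one_lt_r : 1 < r
  u_nonneg : 0 ≤ u
  u_lt_c : u < c
  c_lt_v : c < v
  v_le_one : v ≤ 1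
  proper : 0 < u ∨ v < 1
  eq_left : ∀ x ∈ Set.Ico u c, (∀ i < l, f^[i] x ≠ c) → g x = f^[l] x
  eq_right : ∀ x ∈ Set.Ioc c v, (∀ i < r, f^[i] x ≠ c) → g x = f^[r] x
  lim_left_pt : ∀ x ∈ Set.Ico u c,
    Filter.Tendsto (f^[l]) (nhdsWithin x (Set.Ioi x)) (nhds (g x))
  lim_right_pt : ∀ x ∈ Set.Ioc c v,
    Filter.Tendsto (f^[r]) (nhdsWithin x (Set.Iio x)) (nhds (g x))
  lim_c_left : Filter.Tendsto (f^[l]) (nhdsWithin c (Set.Iio c)) (nhds v)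
  lim_c_right : Filter.Tendsto (f^[r]) (nhdsWithin c (Set.Ioi c)) (nhds u)
  lorenz : IsExpandingLorenzOn g c u v

/-- The forward orbit of `x` enters the set `S` with a `c`-free prefix:
there is `n ≥ 0` with `f^[i] x ≠ c` for `0 ≤ i < n` and `f^[n] x ∈ S`. -/
def CFreeEnters (f : ℝ → ℝ) (c : ℝ) (S : Set ℝ) (x : ℝ) : Prop :=
  ∃ n : ℕ, (∀ i < n, f^[i] x ≠ c) ∧ f^[n] x ∈ S

/-- `N(U) = min {n ≥ 0 : f^[n] z = c for some z ∈ U}`. -/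
noncomputable def hitTime (f : ℝ → ℝ) (c : ℝ) (U : Set ℝ) : ℕ :=
  sInf {n : ℕ | ∃ z ∈ U, f^[n] z = c}

/-- `x ∈ [0,1]` is a `c`-free periodic point of `f` of (exact) period `p`. -/
def IsCFreePeriodic (f : ℝ → ℝ) (c x : ℝ) (p : ℕ) : Prop :=
  x ∈ Set.Icc (0:ℝ) 1 ∧ f^[p] x = x ∧ (∀ i : ℕ, 0 < i → i < p → f^[i] x ≠ x) ∧
    ∀ i < p, f^[i] x ≠ c

/-- Topological transitivity of `f` as a map of `[0,1]`. -/
def LorenzTransitive (f : ℝ → ℝ) : Prop :=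
  ∀ U V : Set ℝ, IsOpen U → IsOpen V →
    (U ∩ Set.Icc 0 1).Nonempty → (V ∩ Set.Icc 0 1).Nonempty →
    ∃ n : ℕ, (f^[n] '' (U ∩ Set.Icc 0 1) ∩ (V ∩ Set.Icc 0 1)).Nonempty

/-- `f` is locally eventually onto: every nonempty (relatively) open subset of `[0,1]`
contains open intervals mapped homeomorphically onto `(0,c)` and onto `(c,1)`
by suitable iterates of `f`. -/
def LocallyEventuallyOnto (f : ℝ → ℝ) (c : ℝ) : Prop :=
  ∀ U : Set ℝ, IsOpen U → (U ∩ Set.Icc 0 1).Nonempty →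
    (∃ a b : ℝ, a < b ∧ Set.Ioo a b ⊆ U ∩ Set.Icc 0 1 ∧ ∃ n : ℕ,
      ContinuousOn (f^[n]) (Set.Ioo a b) ∧ Set.InjOn (f^[n]) (Set.Ioo a b) ∧
        f^[n] '' Set.Ioo a b = Set.Ioo 0 c) ∧
    (∃ a b : ℝ, a < b ∧ Set.Ioo a b ⊆ U ∩ Set.Icc 0 1 ∧ ∃ n : ℕ,
      ContinuousOn (f^[n]) (Set.Ioo a b) ∧ Set.InjOn (f^[n]) (Set.Ioo a b) ∧
        f^[n] '' Set.Ioo a b = Set.Ioo c 1)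

/-- The generalized backward orbit of `x`: points joined to `x` by a chain
following `f`, where at the critical point `c` the chain may continue with
either `0` or `1`. -/
def GenBackwardOrbit (f : ℝ → ℝ) (c x : ℝ) : Set ℝ :=
  {y | y ∈ Set.Icc (0:ℝ) 1 ∧ ∃ (k : ℕ) (w : ℕ → ℝ), w 0 = y ∧ w k = x ∧
    ∀ i < k, (w i ≠ c → w (i + 1) = f (w i)) ∧ (w i = c → w (i + 1) = 0 ∨ w (i + 1) = 1)}
/-- Mean value inequality with a finite exceptional set. -/
theorem mul_sub_le_image_sub_of_finite_exceptional {g : ℝ → ℝ} {lam : ℝ} (F : Finset ℝ) :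
    ∀ {u v : ℝ}, u ≤ v → ContinuousOn g (Icc u v) →
      (∀ x ∈ Ioo u v, x ∉ F → ∃ d : ℝ, HasDerivAt g d x ∧ lam ≤ d) →
      lam * (v - u) ≤ g v - g u := by
  induction F using Finset.induction_on with
  | empty =>
    intro u v huv hg hd
    have hd' : ∀ x ∈ interior (Icc u v), ∃ d : ℝ, HasDerivAt g d x ∧ lam ≤ d := by
      intro x hx
      rw [interior_Icc] at hx
      exact hd x hx (by simp)
    refine (convex_Icc u v).mul_sub_le_image_sub_of_le_deriv hg ?_ ?_ u ⟨le_rfl, huv⟩ v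
      ⟨huv, le_rfl⟩ huv
    · intro x hx
      obtain ⟨d, h, -⟩ := hd' x hx
      exact h.differentiableAt.differentiableWithinAt
    · intro x hx
      obtain ⟨d, h, hl⟩ := hd' x hx
      rwa [h.deriv]
  | insert a F _ ih =>
    intro u v huv hg hd
    by_cases ha : a ∈ Ioo u v
    · have h1 := ih ha.1.le (hg.mono (Icc_subset_Icc_right ha.2.le)) fun x hx hxF =>
        hd x ⟨hx.1, hx.2.trans ha.2⟩ (by simp [hx.2.ne, hxF])
      have h2 := ih ha.2.le (hg.mono (Icc_subset_Icc_left ha.1.le)) fun x hx hxF =>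
        hd x ⟨ha.1.trans hx.1, hx.2⟩ (by simp [hx.1.ne', hxF])
      linarith
    · refine ih huv hg fun x hx hxF => hd x hx ?_
      have : x ≠ a := fun h => ha (h ▸ hx)
      simp [this, hxF]

theorem finite_closure_diff_of_isPreconnected {I : Set ℝ} (hI : IsPreconnected I) :
    (closure I \ I).Finite := by
  have hsub : closure I \ I ⊆ {x | IsLUB I x} ∪ {x | IsGLB I x} := by
    rintro x ⟨hx, hxI⟩
    by_cases h : x ∈ upperBounds I
    · exact Or.inl (isLUB_of_mem_closure h hx)
    · refine Or.inr (isGLB_of_mem_closure ?_ hx)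
      simp only [mem_upperBounds, not_forall, not_le] at h
      obtain ⟨z, hz, hxz⟩ := h
      intro y hy
      by_contra hyx
      exact hxI (hI.ordConnected.out hy hz ⟨(not_le.1 hyx).le, hxz.le⟩)
  refine Set.Finite.subset (Set.Finite.union ?_ ?_) hsub
  · exact Set.Subsingleton.finite fun x hx y hy => IsLUB.unique hx hy
  · exact Set.Subsingleton.finite fun x hx y hy => IsGLB.unique hx hy

theorem finite_closure_diff_union {X : Type*} [TopologicalSpace X] {S T : Set X}
    (hS : (closure S \ S).Finite) (hT : (closure T \ T).Finite) :
    (closure (S ∪ T) \ (S ∪ T)).Finite := by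
  refine (hS.union hT).subset ?_
  rw [closure_union]
  rintro x ⟨hx | hx, hn⟩
  · exact Or.inl ⟨hx, fun h => hn (Or.inl h)⟩
  · exact Or.inr ⟨hx, fun h => hn (Or.inr h)⟩

namespace IsExpandingLorenz

variable {f : ℝ → ℝ} {c : ℝ}

theorem continuousOn_update_Icc (hf : IsExpandingLorenz f c) :
    ContinuousOn (update f c 1) (Icc 0 c) := by
  intro x hx
  rcases hx.2.lt_or_eq with h | rfl
  · have h1 : ContinuousWithinAt f (Icc 0 c) x := by
      refine (hf.cont_left x ⟨hx.1, h⟩).mono_of_mem_nhdsWithin ?_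
      exact mem_nhdsWithin.2 ⟨Iio c, isOpen_Iio, h, fun y hy => ⟨hy.2.1, hy.1⟩⟩
    refine h1.congr_of_eventuallyEq ?_ (update_of_ne h.ne _ _)
    filter_upwards [mem_nhdsWithin_of_mem_nhds (Iio_mem_nhds h)] with y hy
    exact update_of_ne (ne_of_lt hy) _ _
  · rw [continuousWithinAt_update_same]
    exact hf.lim_left.mono_left (nhdsWithin_mono _ fun y hy => lt_of_le_of_ne hy.1.2 hy.2)

theorem continuousOn_Icc_right (hf : IsExpandingLorenz f c) (hc : f c = 0) :
    ContinuousOn f (Icc c 1) := by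
  intro x hx
  rcases hx.1.lt_or_eq with h | rfl
  · refine (hf.cont_right x ⟨h, hx.2⟩).mono_of_mem_nhdsWithin ?_
    exact mem_nhdsWithin.2 ⟨Ioi c, isOpen_Ioi, h, fun y hy => ⟨hy.1, hy.2.2⟩⟩
  · have h : ContinuousWithinAt f (Ioi c) c := by
      have := hf.lim_right
      rwa [← hc] at this
    exact (continuousWithinAt_Ioi_iff_Ici.1 h).mono Icc_subset_Ici_self

theorem exists_expansion (hf : IsExpandingLorenz f c) (hc : f c = 0) :
    ∃ lam : ℝ, 1 < lam ∧
      (∀ u v, 0 ≤ u → u ≤ v → v ≤ c → lam * (v - u) ≤ update f c 1 v - update f c 1 u) ∧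
      (∀ u v, c ≤ u → u ≤ v → v ≤ 1 → lam * (v - u) ≤ f v - f u) := by
  obtain ⟨F, hF, lam, hlam, hd⟩ := hf.expanding
  have hderiv : ∀ x ∈ Ioo (0 : ℝ) 1, x ∉ hF.toFinset → ∃ d : ℝ, HasDerivAt f d x ∧ lam ≤ d := by
    intro x hx hxF
    obtain ⟨d, h, hl⟩ := hd x ⟨Ioo_subset_Icc_self hx, by simpa using hxF⟩
    exact ⟨d, h.hasDerivAt (Icc_mem_nhds hx.1 hx.2), hl⟩
  have h0 := hf.a_lt_c
  have h1 := hf.c_lt_b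
  refine ⟨lam, hlam, fun u v hu huv hv => ?_, fun u v hu huv hv => ?_⟩
  · refine mul_sub_le_image_sub_of_finite_exceptional hF.toFinset huv
      (hf.continuousOn_update_Icc.mono (Icc_subset_Icc hu hv)) fun x hx hxF => ?_
    obtain ⟨d, h, hl⟩ := hderiv x ⟨hu.trans_lt hx.1, (hx.2.trans_le hv).trans h1⟩ hxF
    refine ⟨d, h.congr_of_eventuallyEq ?_, hl⟩
    filter_upwards [Iio_mem_nhds (hx.2.trans_le hv)] with y hy
    exact update_of_ne (ne_of_lt hy) _ _
  · exact mul_sub_le_image_sub_of_finite_exceptional hF.toFinset huv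
      ((hf.continuousOn_Icc_right hc).mono (Icc_subset_Icc hu hv)) fun x hx hxF =>
        hderiv x ⟨(h0.trans_le hu).trans hx.1, hx.2.trans_le hv⟩ hxF

end IsExpandingLorenz

/-- `K ⊆ [0,1]` contains all preimages of its points under both one-sided versions of `f`. -/
structure IsBackwardClosed (f : ℝ → ℝ) (c : ℝ) (K : Set ℝ) : Prop where
  subset : K ⊆ Icc 0 1
  preimage : ∀ y ∈ Icc (0 : ℝ) 1, f y ∈ K → y ∈ K
  preimage_update : ∀ y ∈ Icc (0 : ℝ) 1, update f c 1 y ∈ K → y ∈ K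

theorem isBackwardClosed_genBackwardOrbit {f : ℝ → ℝ} {c : ℝ} (hc : f c = 0) (x : ℝ) :
    IsBackwardClosed f c (GenBackwardOrbit f c x) := by
  have key : ∀ y ∈ Icc (0 : ℝ) 1, ∀ z ∈ GenBackwardOrbit f c x,
      (y ≠ c → z = f y) → (y = c → z = 0 ∨ z = 1) → y ∈ GenBackwardOrbit f c x := by
    rintro y hy z ⟨-, k, w, hw0, hwk, hw⟩ h1 h2
    refine ⟨hy, k + 1, fun i => Nat.casesOn i y w, rfl, hwk, ?_⟩
    rintro (_ | i) hi
    · simpa [hw0] using And.intro h1 h2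
    · exact hw i (by omega)
  refine ⟨fun y hy => hy.1, fun y hy h => key y hy _ h (fun _ => rfl) ?_,
    fun y hy h => key y hy _ h (fun h => update_of_ne h _ _) ?_⟩
  · rintro rfl
    exact Or.inl hc
  · rintro rfl
    exact Or.inr (update_self _ _ _)

namespace IsBackwardClosed

variable {f : ℝ → ℝ} {c lam : ℝ} {K : Set ℝ}

/-- An interval disjoint from `K` expands until it contains `c` in its interior. -/
theorem exists_Icc_around_critical (hK : IsBackwardClosed f c K) (hf : IsExpandingLorenz f c)
    (hc : f c = 0)
    (hL : ∀ u v, 0 ≤ u → u ≤ v → v ≤ c → lam * (v - u) ≤ update f c 1 v - update f c 1 u)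
    (hR : ∀ u v, c ≤ u → u ≤ v → v ≤ 1 → lam * (v - u) ≤ f v - f u) (hlam : 1 < lam) (n : ℕ) :
    ∀ u v : ℝ, u < v → 1 ≤ lam ^ n * (v - u) → Icc u v ⊆ Icc 0 1 \ K →
      ∃ u' v', u' < c ∧ c < v' ∧ Icc u' v' ⊆ Icc 0 1 \ K := by
  have h0 := hf.a_lt_c
  have h1 := hf.c_lt_b
  induction n with
  | zero =>
    intro u v huv hn hsub
    have hu := (hsub ⟨le_rfl, huv.le⟩).1
    have hv := (hsub ⟨huv.le, le_rfl⟩).1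
    refine ⟨u, v, ?_, ?_, hsub⟩ <;> linarith [hu.1, hv.2]
  | succ n ih =>
    intro u v huv hn hsub
    have hu := (hsub ⟨le_rfl, huv.le⟩).1
    have hv := (hsub ⟨huv.le, le_rfl⟩).1
    have step : ∀ g : ℝ → ℝ, ContinuousOn g (Icc u v) → lam * (v - u) ≤ g v - g u →
        (∀ y ∈ Icc (0 : ℝ) 1, g y ∈ Icc (0 : ℝ) 1) → (∀ y ∈ Icc (0 : ℝ) 1, g y ∈ K → y ∈ K) →
        ∃ u' v', u' < c ∧ c < v' ∧ Icc u' v' ⊆ Icc 0 1 \ K := by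
      intro g hg hexp hmaps hpre
      refine ih (g u) (g v) (by nlinarith) ?_ ?_
      · calc 1 ≤ lam ^ (n + 1) * (v - u) := hn
          _ = lam ^ n * (lam * (v - u)) := by ring
          _ ≤ lam ^ n * (g v - g u) := by gcongr
      · intro z hz
        obtain ⟨y, hy, rfl⟩ := intermediate_value_Icc huv.le hg hz
        exact ⟨hmaps y (hsub hy).1, fun h => (hsub hy).2 (hpre y (hsub hy).1 h)⟩
    rcases le_or_gt v c with hvc | hvc
    · refine step (update f c 1) (hf.continuousOn_update_Icc.mono (Icc_subset_Icc hu.1 hvc))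
        (hL u v hu.1 huv.le hvc) (fun y hy => ?_) hK.preimage_update
      rcases eq_or_ne y c with rfl | hne
      · simp
      · rw [update_of_ne hne]
        exact hf.mapsTo hy
    rcases le_or_gt c u with huc | huc
    · exact step f ((hf.continuousOn_Icc_right hc).mono (Icc_subset_Icc huc hv.2))
        (hR u v huc huv.le hv.2) hf.mapsTo hK.preimage
    · exact ⟨u, v, huc, hvc, hsub⟩

/-- An interval disjoint from `K` sweeps out, before it falls into the gap around `c`, a set
with finite frontier outside itself. -/
theorem exists_sweep (hK : IsBackwardClosed f c K) (hf : IsExpandingLorenz f c)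
    (hL : ∀ u v, 0 ≤ u → u ≤ v → v ≤ c → lam * (v - u) ≤ update f c 1 v - update f c 1 u)
    (hR : ∀ u v, c ≤ u → u ≤ v → v ≤ 1 → lam * (v - u) ≤ f v - f u) (hlam : 1 < lam) (n : ℕ) :
    ∀ I : Set ℝ, IsPreconnected I → I ⊆ Icc 0 1 \ K →
      ∀ u ∈ I, ∀ v ∈ I, u < v → 1 ≤ lam ^ n * (v - u) →
      ∃ S : Set ℝ, S ∩ K = ∅ ∧ (closure S \ S).Finite ∧
        I ⊆ S ∪ connectedComponentIn (Icc 0 1 \ K) c ∧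
        MapsTo f S (S ∪ connectedComponentIn (Icc 0 1 \ K) c) := by
  have h0 := hf.a_lt_c
  have h1 := hf.c_lt_b
  have hit : ∀ I : Set ℝ, IsPreconnected I → I ⊆ Icc 0 1 \ K → c ∈ I →
      ∃ S : Set ℝ, S ∩ K = ∅ ∧ (closure S \ S).Finite ∧
        I ⊆ S ∪ connectedComponentIn (Icc 0 1 \ K) c ∧
        MapsTo f S (S ∪ connectedComponentIn (Icc 0 1 \ K) c) := fun I hI hsub hcI =>
    ⟨∅, by simp, by simp, by simpa using hI.subset_connectedComponentIn hcI hsub,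
      mapsTo_empty _ _⟩
  induction n with
  | zero =>
    intro I hI hsub u hu v hv huv hn
    have hu' := (hsub hu).1
    have hv' := (hsub hv).1
    refine hit I hI hsub (hI.ordConnected.out hu hv ⟨?_, ?_⟩) <;> linarith [hu'.1, hv'.2]
  | succ n ih =>
    intro I hI hsub u hu v hv huv hn
    by_cases hcI : c ∈ I
    · exact hit I hI hsub hcI
    have hu' := (hsub hu).1
    have hv' := (hsub hv).1
    have hcont_exp : ContinuousOn f I ∧ lam * (v - u) ≤ f v - f u := by
      rcases lt_or_gt_of_ne (fun h => hcI (h ▸ hu) : u ≠ c) with huc | huc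
      · have hlt : ∀ y ∈ I, y < c := fun y hy => by
          by_contra h
          exact hcI (hI.ordConnected.out hu hy ⟨huc.le, not_lt.1 h⟩)
        refine ⟨hf.cont_left.mono fun y hy => ⟨(hsub hy).1.1, hlt y hy⟩, ?_⟩
        have := hL u v hu'.1 huv.le (hlt v hv).le
        rwa [update_of_ne (hlt v hv).ne, update_of_ne huc.ne] at this
      · have hgt : ∀ y ∈ I, c < y := fun y hy => by
          by_contra h
          exact hcI (hI.ordConnected.out hy hu ⟨not_lt.1 h, huc.le⟩)
        exact ⟨hf.cont_right.mono fun y hy => ⟨hgt y hy, (hsub hy).1.2⟩,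
          hR u v huc.le huv.le hv'.2⟩
    obtain ⟨hcont, hexp⟩ := hcont_exp
    have himg : f '' I ⊆ Icc 0 1 \ K := by
      rintro _ ⟨y, hy, rfl⟩
      exact ⟨hf.mapsTo (hsub hy).1, fun h => (hsub hy).2 (hK.preimage y (hsub hy).1 h)⟩
    obtain ⟨S, hSK, hSfin, hIS, hSS⟩ := ih (f '' I) (hI.image f hcont) himg (f u)
      (mem_image_of_mem f hu) (f v) (mem_image_of_mem f hv) (by nlinarith) (by
        calc 1 ≤ lam ^ (n + 1) * (v - u) := hn
          _ = lam ^ n * (lam * (v - u)) := by ring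
          _ ≤ lam ^ n * (f v - f u) := by gcongr)
    refine ⟨I ∪ S, ?_, finite_closure_diff_union (finite_closure_diff_of_isPreconnected hI) hSfin,
      fun y hy => Or.inl (Or.inl hy), ?_⟩
    · rw [union_inter_distrib_right, hSK, union_empty]
      exact (disjoint_left.2 fun y hy => (hsub hy).2).inter_eq
    · rintro y (hy | hy)
      · exact (hIS (mem_image_of_mem f hy)).imp_left Or.inr
      · exact (hSS hy).imp_left Or.inr

/-- For a transitive map, a set containing all preimages of its points that leaves a
neighbourhood of `c` uncovered is finite. -/
theorem finite_of_Icc_subset (hK : IsBackwardClosed f c K) (hf : IsExpandingLorenz f c)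
    (hc : f c = 0) (htrans : LorenzTransitive f) {u v : ℝ} (huc : u < c) (hcv : c < v)
    (huv : Icc u v ⊆ Icc 0 1 \ K) : K.Finite := by
  obtain ⟨lam, hlam, hL, hR⟩ := hf.exists_expansion hc
  set G := connectedComponentIn (Icc 0 1 \ K) c with hG
  have hcuv : c ∈ Icc u v := ⟨huc.le, hcv.le⟩
  have huvG : Icc u v ⊆ G := isPreconnected_Icc.subset_connectedComponentIn hcuv huv
  have hGsub : G ⊆ Icc 0 1 \ K := connectedComponentIn_subset _ _
  have hGconn : IsPreconnected G := isPreconnected_connectedComponentIn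
  have himg : ∀ A ⊆ G, f '' A ⊆ Icc 0 1 \ K := by
    rintro A hA _ ⟨y, hy, rfl⟩
    have hy' := hGsub (hA hy)
    exact ⟨hf.mapsTo hy'.1, fun h => hy'.2 (hK.preimage y hy'.1 h)⟩
  have sweep : ∀ A ⊆ G, A.OrdConnected → ContinuousOn f A →
      ∀ p ∈ A, ∀ q ∈ A, f p < f q → ∃ S : Set ℝ, S ∩ K = ∅ ∧ (closure S \ S).Finite ∧
        f '' A ⊆ S ∪ G ∧ MapsTo f S (S ∪ G) := by
    intro A hA hAo hAc p hp q hq hpq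
    obtain ⟨n, hn⟩ := pow_unbounded_of_one_lt (1 / (f q - f p)) hlam
    refine hK.exists_sweep hf hL hR hlam n (f '' A) (hAo.isPreconnected.image f hAc) (himg A hA)
      (f p) (mem_image_of_mem f hp) (f q) (mem_image_of_mem f hq) hpq ?_
    rw [div_lt_iff₀ (sub_pos.2 hpq)] at hn
    exact hn.le
  have hu0 : 0 ≤ u := (huv ⟨le_rfl, huc.le.trans hcv.le⟩).1.1
  have hv1 : v ≤ 1 := (huv ⟨huc.le.trans hcv.le, le_rfl⟩).1.2
  obtain ⟨S₁, hS₁K, hS₁fin, hGS₁, hS₁⟩ := sweep (G ∩ Ico 0 c) inter_subset_left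
    (hGconn.ordConnected.inter ordConnected_Ico) (hf.cont_left.mono inter_subset_right)
    u ⟨huvG ⟨le_rfl, huc.le.trans hcv.le⟩, hu0, huc⟩
    ((u + c) / 2) ⟨huvG ⟨by linarith, by linarith⟩, by linarith, by linarith⟩
    (hf.mono_left ⟨hu0, huc⟩ ⟨by linarith, by linarith⟩ (by linarith))
  obtain ⟨S₂, hS₂K, hS₂fin, hGS₂, hS₂⟩ := sweep (G ∩ Icc c 1) inter_subset_left
    (hGconn.ordConnected.inter ordConnected_Icc)
    ((hf.continuousOn_Icc_right hc).mono inter_subset_right)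
    c ⟨huvG hcuv, le_rfl, hf.c_lt_b.le⟩ v ⟨huvG ⟨huc.le.trans hcv.le, le_rfl⟩, hcv.le, hv1⟩
    (by nlinarith [hR c v le_rfl hcv.le hv1])
  have hR_maps : MapsTo f (S₁ ∪ S₂ ∪ G) (S₁ ∪ S₂ ∪ G) := by
    rintro y ((hy | hy) | hy)
    · rcases hS₁ hy with h | h <;> simp [h]
    · rcases hS₂ hy with h | h <;> simp [h]
    · rcases lt_or_ge y c with hyc | hyc
      · rcases hGS₁ (mem_image_of_mem f ⟨hy, (hGsub hy).1.1, hyc⟩) with h | h <;> simp [h]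
      · rcases hGS₂ (mem_image_of_mem f ⟨hy, hyc, (hGsub hy).1.2⟩) with h | h <;> simp [h]
  have hdense : Icc 0 1 ⊆ closure (S₁ ∪ S₂ ∪ G) := by
    intro z hz
    rw [mem_closure_iff]
    intro V hV hzV
    obtain ⟨n, _, ⟨y, hy, rfl⟩, hyV⟩ := htrans (Ioo u v) V isOpen_Ioo hV
      ⟨c, ⟨huc, hcv⟩, (huv hcuv).1⟩ ⟨z, hzV, hz⟩
    exact ⟨_, hyV.1, hR_maps.iterate n (Or.inr (huvG (Ioo_subset_Icc_self hy.1)))⟩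
  refine (finite_closure_diff_union (finite_closure_diff_union hS₁fin hS₂fin)
    (finite_closure_diff_of_isPreconnected hGconn)).subset fun k hk =>
      ⟨hdense (hK.subset hk), ?_⟩
  rintro ((h | h) | h)
  · exact eq_empty_iff_forall_notMem.1 hS₁K k ⟨h, hk⟩
  · exact eq_empty_iff_forall_notMem.1 hS₂K k ⟨h, hk⟩
  · exact (hGsub h).2 hk

/-- Small neighbourhoods of `K` contain all preimages of their points, provided `K` stays away
from `f 0` and `f 1`. -/
theorem exists_dist_lt_of_dist_lt (hK : IsBackwardClosed f c K) (hf : IsExpandingLorenz f c)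
    (hc : f c = 0) {ε : ℝ} (hε0 : ∀ k ∈ K, ε ≤ dist k (f 0))
    (hε1 : ∀ k ∈ K, ε ≤ dist k (f 1)) {y : ℝ} (hy : y ∈ Icc (0 : ℝ) 1) {k : ℝ} (hk : k ∈ K)
    (hyk : dist (f y) k < ε) : ∃ k' ∈ K, dist y k' < ε := by
  obtain ⟨lam, hlam, hL, hR⟩ := hf.exists_expansion hc
  have h0 := hf.a_lt_c
  have h1 := hf.c_lt_b
  have hk01 := hK.subset hk
  have hke0 := hε0 k hk
  have hke1 := hε1 k hk
  rw [Real.dist_eq] at hyk hke0 hke1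
  have hyk' := abs_lt.1 hyk
  have close : ∀ g : ℝ → ℝ, ∀ a b : ℝ,
      (∀ u v, a ≤ u → u ≤ v → v ≤ b → lam * (v - u) ≤ g v - g u) →
      ∀ k' ∈ Icc a b, y ∈ Icc a b → dist y k' ≤ |g y - g k'| := by
    intro g a b hg k' hk' hy'
    rw [Real.dist_eq]
    rcases le_total y k' with h | h
    · have := hg y k' hy'.1 h hk'.2
      rw [abs_sub_comm, abs_sub_comm (g y), abs_of_nonneg (sub_nonneg.2 h)]
      exact le_trans (by nlinarith) (le_abs_self _)
    · have := hg k' y hk'.1 h hy'.2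
      rw [abs_of_nonneg (sub_nonneg.2 h)]
      exact le_trans (by nlinarith) (le_abs_self _)
  rcases lt_or_ge y c with hyc | hyc
  · have hf0 : f 0 ≤ f y := hf.mono_left.monotoneOn ⟨le_rfl, h0⟩ ⟨hy.1, hyc⟩ hy.1
    have hk0 : f 0 ≤ k := by
      by_contra! h
      rw [abs_of_neg (by linarith)] at hke0
      linarith
    have hivt := intermediate_value_Icc h0.le hf.continuousOn_update_Icc
    rw [update_of_ne h0.ne, update_self] at hivt
    obtain ⟨k', hk', hkk'⟩ := hivt ⟨hk0, hk01.2⟩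
    refine ⟨k', hK.preimage_update k' ⟨hk'.1, hk'.2.trans h1.le⟩ (hkk' ▸ hk), ?_⟩
    have := close _ 0 c hL k' hk' ⟨hy.1, hyc.le⟩
    rw [hkk', update_of_ne hyc.ne] at this
    exact this.trans_lt hyk
  · have hf1 : f y ≤ f 1 := by nlinarith [hR y 1 hyc hy.2 le_rfl, hy.2]
    have hk1 : k ≤ f 1 := by
      by_contra! h
      rw [abs_of_pos (by linarith)] at hke1
      linarith
    have hivt := intermediate_value_Icc h1.le (hf.continuousOn_Icc_right hc)
    rw [hc] at hivt
    obtain ⟨k', hk', hkk'⟩ := hivt ⟨hk01.1, hk1⟩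
    refine ⟨k', hK.preimage k' ⟨h0.le.trans hk'.1, hk'.2⟩ (hkk' ▸ hk), ?_⟩
    have := close _ c 1 hR k' hk' ⟨hyc, hy.2⟩
    rw [hkk'] at this
    exact this.trans_lt hyk

/-- For a transitive map, a nonempty finite set containing all preimages of its points
contains `c`. -/
theorem critical_mem_of_finite (hK : IsBackwardClosed f c K) (hf : IsExpandingLorenz f c)
    (hc : f c = 0) (htrans : LorenzTransitive f) (hfin : K.Finite) (hne : K.Nonempty) :
    c ∈ K := by
  by_contra hcK
  have hc01 : c ∈ Icc (0 : ℝ) 1 := ⟨hf.a_lt_c.le, hf.c_lt_b.le⟩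
  have h0K : f 0 ∉ K := fun h =>
    hcK (hK.preimage c hc01 (hc ▸ hK.preimage 0 ⟨le_rfl, zero_le_one⟩ h))
  have h1K : f 1 ∉ K := fun h => hcK (hK.preimage_update c hc01
    ((update_self c (1 : ℝ) f).symm ▸ hK.preimage 1 ⟨zero_le_one, le_rfl⟩ h))
  have away : ∀ z ∉ K, ∃ ε > 0, ∀ k ∈ K, ε ≤ dist k z := by
    intro z hz
    obtain ⟨ε, hε, hball⟩ := Metric.isOpen_iff.1 hfin.isClosed.isOpen_compl z hz
    exact ⟨ε, hε, fun k hk => not_lt.1 fun h => hball (Metric.mem_ball.2 h) hk⟩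
  obtain ⟨ε₀, hε₀, h₀⟩ := away _ h0K
  obtain ⟨ε₁, hε₁, h₁⟩ := away _ h1K
  obtain ⟨ε₂, hε₂, h₂⟩ := away _ hcK
  obtain ⟨ε, hε, hle₀, hle₁, hle₂⟩ : ∃ ε > 0, ε ≤ ε₀ ∧ ε ≤ ε₁ ∧ ε + ε ≤ ε₂ := by
    refine ⟨min (min ε₀ ε₁) (ε₂ / 2), by positivity, (min_le_left _ _).trans (min_le_left _ _),
      (min_le_left _ _).trans (min_le_right _ _), ?_⟩
    linarith [min_le_right (min ε₀ ε₁) (ε₂ / 2)]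
  have pull : ∀ n : ℕ, ∀ y ∈ Icc (0 : ℝ) 1, ∀ k ∈ K, dist (f^[n] y) k < ε →
      ∃ k' ∈ K, dist y k' < ε := by
    intro n
    induction n with
    | zero => exact fun y _ k hk h => ⟨k, hk, h⟩
    | succ n ih =>
      intro y hy k hk h
      obtain ⟨k', hk', h'⟩ := ih (f y) (hf.mapsTo hy) k hk h
      exact hK.exists_dist_lt_of_dist_lt hf hc (fun k hk => hle₀.trans (h₀ k hk))
        (fun k hk => hle₁.trans (h₁ k hk)) hy hk' h'
  obtain ⟨x, hx⟩ := hne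
  obtain ⟨n, _, ⟨y, hy, rfl⟩, hyV⟩ := htrans (Metric.ball c ε) (Metric.ball x ε)
    Metric.isOpen_ball Metric.isOpen_ball ⟨c, Metric.mem_ball_self hε, hc01⟩
    ⟨x, Metric.mem_ball_self hε, hK.subset hx⟩
  obtain ⟨k, hk, hyk⟩ := pull n y hy.2 x hx hyV.1
  have := h₂ k hk
  have := dist_triangle_left k c y
  have := Metric.mem_ball.1 hy.1
  linarith

theorem subset_closure (hK : IsBackwardClosed f c K) (hf : IsExpandingLorenz f c)
    (hc : f c = 0) (htrans : LorenzTransitive f) (hne : K.Nonempty) :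
    Icc (0 : ℝ) 1 ⊆ closure K := by
  obtain ⟨lam, hlam, hL, hR⟩ := hf.exists_expansion hc
  have hIoo : Ioo (0 : ℝ) 1 ⊆ closure K := by
    intro z hz
    by_contra hzK
    have hnhds : Ioo 0 1 ∩ (closure K)ᶜ ∈ 𝓝 z :=
      inter_mem (Ioo_mem_nhds hz.1 hz.2) (isClosed_closure.isOpen_compl.mem_nhds hzK)
    obtain ⟨δ, hδ, hball⟩ := Metric.nhds_basis_closedBall.mem_iff.1 hnhds
    rw [Real.closedBall_eq_Icc] at hball
    have hlen : 0 < (z + δ) - (z - δ) := by linarith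
    obtain ⟨n, hn⟩ := pow_unbounded_of_one_lt (1 / ((z + δ) - (z - δ))) hlam
    rw [div_lt_iff₀ hlen] at hn
    obtain ⟨u, v, huc, hcv, huv⟩ := hK.exists_Icc_around_critical hf hc hL hR hlam n
      (z - δ) (z + δ) (sub_pos.1 hlen) hn.le fun y hy =>
        ⟨Ioo_subset_Icc_self (hball hy).1, fun h => (hball hy).2 (_root_.subset_closure h)⟩
    exact (huv ⟨huc.le, hcv.le⟩).2 (hK.critical_mem_of_finite hf hc htrans
      (hK.finite_of_Icc_subset hf hc htrans huc hcv huv) hne)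
  rw [← closure_Ioo (zero_ne_one' ℝ)]
  exact closure_minimal hIoo isClosed_closure

end IsBackwardClosed

/-- in a transitive expanding Lorenz map, every generalized backward
orbit is dense in `[0,1]`. -/
theorem backward_orbit_dense_of_transitive
    (f : ℝ → ℝ) (c : ℝ) (hf : IsExpandingLorenz f c) (hc : f c = 0)
    (htrans : LorenzTransitive f) :
    ∀ x ∈ Set.Icc (0:ℝ) 1, Set.Icc (0:ℝ) 1 ⊆ closure (GenBackwardOrbit f c x) := by
  intro x hx
  exact (isBackwardClosed_genBackwardOrbit hc x).subset_closure hf hc htrans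
    ⟨x, hx, 0, fun _ => x, rfl, rfl, fun i hi => absurd hi (Nat.not_lt_zero i)⟩
end

section
/- Let f be an expanding Lorenz map with critical point c. Then f(0) < f(1), and the number m = min{i ≥ 0 : there exists z ∈ [f(0), f(1)] with f^j(z) ≠ c for 0 ≤ j < i and f^i(z) = c} is a well-defined natural number. Moreover, there exists a point x ∈ (0,1) such that f^{m+2}(x) = x, or lim_{y→x⁻} f^{m+2}(y) = x, or lim_{y→x⁺} f^{m+2}(y) = x (the one-sided limits of f^{m+2} exist by piecewise monotonicity); that is, f^{m+2} has a fixed point, possibly in the one-sided-limit sense. -/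
open Set Filter Topology Function

/-- The left-continuous modification of a Lorenz map at its critical point. -/
noncomputable def leftExt (f : ℝ → ℝ) (c x : ℝ) : ℝ := if x = c then 1 else f x

/-- The iterates on `(0,1]` of the left-continuous degree-one lift of a Lorenz map:
every passage through `(c,1]` adds one full turn. -/
noncomputable def liftIter (f : ℝ → ℝ) (c : ℝ) : ℕ → ℝ → ℝ
  | 0, x => x
  | n + 1, x => liftIter f c n (leftExt f c x) + if c < x then 1 else 0

lemma leftExt_self (f : ℝ → ℝ) (c : ℝ) : leftExt f c c = 1 := if_pos rfl

lemma leftExt_of_ne {f : ℝ → ℝ} {c x : ℝ} (h : x ≠ c) : leftExt f c x = f x := if_neg h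

lemma leftExt_iterate_eq {f : ℝ → ℝ} {c : ℝ} (n : ℕ) (x : ℝ) (h : ∀ i < n, f^[i] x ≠ c) :
    (leftExt f c)^[n] x = f^[n] x := by
  induction n with
  | zero => rfl
  | succ n ih =>
    rw [iterate_succ_apply', iterate_succ_apply', ih fun i hi => h i (by omega),
      leftExt_of_ne (h n (by omega))]

lemma liftIter_eq_add_int (f : ℝ → ℝ) (c : ℝ) (n : ℕ) (x : ℝ) :
    ∃ k : ℤ, liftIter f c n x = (leftExt f c)^[n] x + k := by
  induction n generalizing x with
  | zero => exact ⟨0, by simp [liftIter]⟩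
  | succ n ih =>
    obtain ⟨k, hk⟩ := ih (leftExt f c x)
    by_cases h : c < x
    · exact ⟨k + 1, by simp [liftIter, hk, h]; ring⟩
    · exact ⟨k, by simp [liftIter, hk, h]⟩

/-- A lower bound on the derivative off a finite set bounds the increments from below. -/
lemma mul_sub_le_image_sub_of_finite {g : ℝ → ℝ} {lam : ℝ} (F : Finset ℝ) {x y : ℝ}
    (hxy : x ≤ y) (hc : ContinuousOn g (Icc x y))
    (hd : ∀ t ∈ Ioo x y, t ∉ F → ∃ d, HasDerivAt g d t ∧ lam ≤ d) :
    lam * (y - x) ≤ g y - g x := by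
  induction F using Finset.induction_on generalizing x y with
  | empty =>
    rcases hxy.eq_or_lt with rfl | hxy
    · simp
    choose! d hd hl using fun t ht => hd t ht (by simp)
    obtain ⟨t, ht, h⟩ := exists_hasDerivAt_eq_slope g d hxy hc hd
    have := hl t ht
    rwa [h, le_div_iff₀ (sub_pos.2 hxy)] at this
  | insert a F _ ih =>
    by_cases ha : a ∈ Ioo x y
    · have h1 := ih ha.1.le (hc.mono (Icc_subset_Icc_right ha.2.le)) fun t ht htF =>
        hd t ⟨ht.1, ht.2.trans ha.2⟩ (by simp [htF, ht.2.ne])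
      have h2 := ih ha.2.le (hc.mono (Icc_subset_Icc_left ha.1.le)) fun t ht htF =>
        hd t ⟨ha.1.trans ht.1, ht.2⟩ (by simp [htF, ht.1.ne'])
      linarith
    · refine ih hxy hc fun t ht htF => hd t ht ?_
      rintro h
      rcases Finset.mem_insert.1 h with rfl | h
      exacts [ha ht, htF h]

namespace IsExpandingLorenzOn

variable {f : ℝ → ℝ} {c : ℝ}

lemma continuousOn_Icc (hf : IsExpandingLorenzOn f c 0 1) {x y : ℝ} (hx : 0 ≤ x) (hy : y ≤ 1)
    (hc : c ∉ Icc x y) : ContinuousOn f (Icc x y) := by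
  by_cases h : y < c
  · exact hf.cont_left.mono fun t ht => ⟨hx.trans ht.1, ht.2.trans_lt h⟩
  · have h' : c < x := by
      by_contra h'
      exact hc ⟨not_lt.1 h', not_lt.1 h⟩
    exact hf.cont_right.mono fun t ht => ⟨h'.trans_le ht.1, ht.2.trans hy⟩

lemma exists_expansion (hf : IsExpandingLorenzOn f c 0 1) :
    ∃ lam : ℝ, 1 < lam ∧ ∀ x y, 0 ≤ x → x ≤ y → y ≤ 1 → c ∉ Icc x y →
      lam * (y - x) ≤ f y - f x := by
  obtain ⟨F, hF, lam, hlam, h⟩ := hf.expanding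
  refine ⟨lam, hlam, fun x y hx hxy hy hc => ?_⟩
  refine mul_sub_le_image_sub_of_finite hF.toFinset hxy (hf.continuousOn_Icc hx hy hc) ?_
  intro t ht htF
  obtain ⟨d, hd, hl⟩ := h t ⟨⟨hx.trans ht.1.le, ht.2.le.trans hy⟩, by simpa using htF⟩
  exact ⟨d, hd.hasDerivAt (Icc_mem_nhds (hx.trans_lt ht.1) (ht.2.trans_le hy)), hl⟩

lemma map_zero_lt_map_one (hf : IsExpandingLorenzOn f c 0 1) : f 0 < f 1 := by
  obtain ⟨lam, hlam, h⟩ := hf.exists_expansion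
  have h0 := hf.a_lt_c
  have h1 := hf.c_lt_b
  have hl : lam * (c - 0) ≤ 1 - f 0 := by
    have e : Tendsto (fun y => lam * (y - 0)) (𝓝[<] c) (𝓝 (lam * (c - 0))) :=
      (Continuous.tendsto (by fun_prop) c).mono_left nhdsWithin_le_nhds
    refine le_of_tendsto_of_tendsto e (hf.lim_left.sub_const (f 0)) ?_
    filter_upwards [Ioo_mem_nhdsLT h0] with y hy
    exact h 0 y le_rfl hy.1.le (hy.2.trans h1).le fun hc => hc.2.not_gt hy.2
  have hr : lam * (1 - c) ≤ f 1 - 0 := by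
    have e : Tendsto (fun y => lam * (1 - y)) (𝓝[>] c) (𝓝 (lam * (1 - c))) :=
      (Continuous.tendsto (by fun_prop) c).mono_left nhdsWithin_le_nhds
    refine le_of_tendsto_of_tendsto e (hf.lim_right.const_sub (f 1)) ?_
    filter_upwards [Ioo_mem_nhdsGT h1] with y hy
    exact h y 1 (h0.trans hy.1).le hy.2.le le_rfl fun hc => hc.1.not_gt hy.1
  linarith

lemma mono_Icc (hf : IsExpandingLorenzOn f c 0 1) {x y : ℝ} (hx : 0 ≤ x) (hxy : x ≤ y)
    (hy : y ≤ 1) (hc : c ∉ Icc x y) : f x ≤ f y := by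
  obtain ⟨lam, hlam, h⟩ := hf.exists_expansion
  have := h x y hx hxy hy hc
  nlinarith

lemma map_lt_one (hf : IsExpandingLorenzOn f c 0 1) {x : ℝ} (hx : x ∈ Ico (0 : ℝ) 1)
    (hc : x ≠ c) : f x < 1 := by
  rcases hc.lt_or_gt with h | h
  · obtain ⟨y, hy, hy'⟩ := exists_between h
    exact (hf.mono_left ⟨hx.1, h⟩ ⟨hx.1.trans hy.le, hy'⟩ hy).trans_le
      (hf.mapsTo ⟨hx.1.trans hy.le, (hy'.trans hf.c_lt_b).le⟩).2
  · exact (hf.mono_right ⟨h, hx.2.le⟩ ⟨hf.c_lt_b, le_rfl⟩ hx.2).trans_le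
      (hf.mapsTo ⟨zero_le_one, le_rfl⟩).2

lemma map_pos (hf : IsExpandingLorenzOn f c 0 1) {x : ℝ} (hx : x ∈ Ioc (0 : ℝ) 1)
    (hc : x ≠ c) : 0 < f x := by
  rcases hc.lt_or_gt with h | h
  · exact (hf.mapsTo ⟨le_rfl, zero_le_one⟩).1.trans_lt
      (hf.mono_left ⟨le_rfl, hf.a_lt_c⟩ ⟨hx.1.le, h⟩ hx.1)
  · obtain ⟨y, hy, hy'⟩ := exists_between h
    exact (hf.mapsTo ⟨(hf.a_lt_c.trans hy).le, hy'.le.trans hx.2⟩).1.trans_lt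
      (hf.mono_right ⟨hy, hy'.le.trans hx.2⟩ ⟨h, hx.2⟩ hy')

lemma leftExt_mem (hf : IsExpandingLorenzOn f c 0 1) {x : ℝ} (hx : x ∈ Ioc (0 : ℝ) 1) :
    leftExt f c x ∈ Ioc (0 : ℝ) 1 := by
  by_cases h : x = c
  · simp [h, leftExt_self]
  · rw [leftExt_of_ne h]
    exact ⟨hf.map_pos hx h, (hf.mapsTo ⟨hx.1.le, hx.2⟩).2⟩

lemma leftExt_iterate_mem (hf : IsExpandingLorenzOn f c 0 1) {x : ℝ} (hx : x ∈ Ioc (0 : ℝ) 1)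
    (n : ℕ) : (leftExt f c)^[n] x ∈ Ioc (0 : ℝ) 1 := by
  induction n with
  | zero => exact hx
  | succ n ih =>
    rw [iterate_succ_apply']
    exact hf.leftExt_mem ih

lemma tendsto_left (hf : IsExpandingLorenzOn f c 0 1) {x : ℝ} (hx : x ∈ Ioc (0 : ℝ) 1) :
    Tendsto f (𝓝[<] x) (𝓝[<] (leftExt f c x)) := by
  rw [tendsto_nhdsWithin_iff]
  rcases lt_trichotomy x c with h | rfl | h
  · rw [leftExt_of_ne h.ne]
    have hs : Ico 0 c ∈ 𝓝[<] x := mem_of_superset (Ioo_mem_nhdsLT hx.1)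
      fun y hy => ⟨hy.1.le, hy.2.trans h⟩
    refine ⟨(hf.cont_left x ⟨hx.1.le, h⟩).mono_of_mem_nhdsWithin hs, ?_⟩
    filter_upwards [hs, self_mem_nhdsWithin] with y hy hy'
    exact hf.mono_left hy ⟨hx.1.le, h⟩ hy'
  · rw [leftExt_self]
    refine ⟨hf.lim_left, ?_⟩
    filter_upwards [Ioo_mem_nhdsLT hx.1] with y hy
    exact hf.map_lt_one ⟨hy.1.le, hy.2.trans hf.c_lt_b⟩ hy.2.ne
  · rw [leftExt_of_ne h.ne']
    have hs : Ioc c 1 ∈ 𝓝[<] x := mem_of_superset (Ioo_mem_nhdsLT h)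
      fun y hy => ⟨hy.1, hy.2.le.trans hx.2⟩
    refine ⟨(hf.cont_right x ⟨h, hx.2⟩).mono_of_mem_nhdsWithin hs, ?_⟩
    filter_upwards [hs, self_mem_nhdsWithin] with y hy hy'
    exact hf.mono_right hy ⟨h, hx.2⟩ hy'

lemma tendsto_right (hf : IsExpandingLorenzOn f c 0 1) {x : ℝ} (hx : x ∈ Ico (0 : ℝ) 1)
    (hc : x ≠ c) : Tendsto f (𝓝[>] x) (𝓝[>] (f x)) := by
  rw [tendsto_nhdsWithin_iff]
  rcases hc.lt_or_gt with h | h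
  · have hs : Ico 0 c ∈ 𝓝[>] x := mem_of_superset (Ioo_mem_nhdsGT h)
      fun y hy => ⟨hx.1.trans hy.1.le, hy.2⟩
    refine ⟨(hf.cont_left x ⟨hx.1, h⟩).mono_of_mem_nhdsWithin hs, ?_⟩
    filter_upwards [hs, self_mem_nhdsWithin] with y hy hy'
    exact hf.mono_left ⟨hx.1, h⟩ hy hy'
  · have hs : Ioc c 1 ∈ 𝓝[>] x := mem_of_superset (Ioo_mem_nhdsGT hx.2)
      fun y hy => ⟨h.trans hy.1, hy.2.le⟩
    refine ⟨(hf.cont_right x ⟨h, hx.2.le⟩).mono_of_mem_nhdsWithin hs, ?_⟩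
    filter_upwards [hs, self_mem_nhdsWithin] with y hy hy'
    exact hf.mono_right ⟨h, hx.2.le⟩ hy hy'

lemma tendsto_right_crit (hf : IsExpandingLorenzOn f c 0 1) :
    Tendsto f (𝓝[>] c) (𝓝[>] 0) := by
  refine tendsto_nhdsWithin_iff.2 ⟨hf.lim_right, ?_⟩
  filter_upwards [Ioo_mem_nhdsGT hf.c_lt_b] with y hy
  exact hf.map_pos ⟨hf.a_lt_c.trans hy.1, hy.2.le⟩ hy.1.ne'

lemma tendsto_iterate_left (hf : IsExpandingLorenzOn f c 0 1) {x : ℝ} (hx : x ∈ Ioc (0 : ℝ) 1)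
    (n : ℕ) : Tendsto f^[n] (𝓝[<] x) (𝓝[<] ((leftExt f c)^[n] x)) := by
  induction n generalizing x with
  | zero => exact tendsto_id
  | succ n ih => exact (ih (hf.leftExt_mem hx)).comp (hf.tendsto_left hx)

lemma tendsto_iterate_right (hf : IsExpandingLorenzOn f c 0 1) {x : ℝ} (hx : x ∈ Ico (0 : ℝ) 1)
    (n : ℕ) (h : ∀ i < n, f^[i] x ≠ c) : Tendsto f^[n] (𝓝[>] x) (𝓝[>] (f^[n] x)) := by
  induction n generalizing x with
  | zero => exact tendsto_id
  | succ n ih =>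
    have hc : x ≠ c := h 0 (by omega)
    exact (ih ⟨(hf.mapsTo ⟨hx.1, hx.2.le⟩).1, hf.map_lt_one hx hc⟩
      fun i hi => h (i + 1) (by omega)).comp (hf.tendsto_right hx hc)

lemma eventually_leftExt_eq_left (x : ℝ) : ∀ᶠ y in 𝓝[<] x, leftExt f c y = f y := by
  rcases le_or_gt x c with h | h
  · filter_upwards [self_mem_nhdsWithin] with y hy
    exact leftExt_of_ne (ne_of_lt (lt_of_lt_of_le hy h))
  · filter_upwards [Ioo_mem_nhdsLT h] with y hy
    exact leftExt_of_ne hy.1.ne'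

lemma tendsto_liftIter_left (hf : IsExpandingLorenzOn f c 0 1) {x : ℝ}
    (hx : x ∈ Ioc (0 : ℝ) 1) (n : ℕ) :
    Tendsto (liftIter f c n) (𝓝[<] x) (𝓝 (liftIter f c n x)) := by
  induction n generalizing x with
  | zero => exact nhdsWithin_le_nhds
  | succ n ih =>
    have h1 : Tendsto (leftExt f c) (𝓝[<] x) (𝓝[<] (leftExt f c x)) :=
      (hf.tendsto_left hx).congr' ((eventually_leftExt_eq_left x).mono fun y hy => hy.symm)
    refine ((ih (hf.leftExt_mem hx)).comp h1).add ?_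
    refine tendsto_const_nhds.congr' ?_
    by_cases h : c < x
    · filter_upwards [Ioo_mem_nhdsLT h] with y hy
      simp [h, hy.1]
    · filter_upwards [self_mem_nhdsWithin] with y hy
      have : ¬ c < y := fun h' => h (h'.trans hy)
      simp [h, this]

/-- The property that no point of an interval meets `c` passes to the image interval. -/
lemma avoids_image (hf : IsExpandingLorenzOn f c 0 1) {a b : ℝ} {n : ℕ} (ha : 0 ≤ a)
    (hab : a ≤ b) (hb : b ≤ 1) (h : ∀ y ∈ Icc a b, ∀ i < n + 1, f^[i] y ≠ c) :
    c ∉ Icc a b ∧ f a ≤ f b ∧ ∀ y ∈ Icc (f a) (f b), ∀ i < n, f^[i] y ≠ c := by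
  have hc : c ∉ Icc a b := fun hc => h c hc 0 (by omega) rfl
  refine ⟨hc, hf.mono_Icc ha hab hb hc, fun y hy i hi => ?_⟩
  obtain ⟨t, ht, rfl⟩ := intermediate_value_Icc hab (hf.continuousOn_Icc ha hb hc) hy
  exact h t ht (i + 1) (by omega)

lemma liftIter_le (hf : IsExpandingLorenzOn f c 0 1) {a b : ℝ} {n : ℕ} (ha : 0 ≤ a)
    (hab : a ≤ b) (hb : b ≤ 1) (h : ∀ y ∈ Icc a b, ∀ i < n, f^[i] y ≠ c) :
    liftIter f c n a ≤ liftIter f c n b := by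
  induction n generalizing a b with
  | zero => exact hab
  | succ n ih =>
    obtain ⟨hc, h1, h2⟩ := hf.avoids_image ha hab hb h
    have hac : a ≠ c := fun e => hc ⟨e.le, e ▸ hab⟩
    have hbc : b ≠ c := fun e => hc ⟨e ▸ hab, e.ge⟩
    have := ih (hf.mapsTo ⟨ha, hab.trans hb⟩).1 h1 (hf.mapsTo ⟨ha.trans hab, hb⟩).2 h2
    simp only [liftIter, leftExt_of_ne hac, leftExt_of_ne hbc]
    refine add_le_add this ?_
    split_ifs with h3 h4
    exacts [le_rfl, absurd (h3.trans_le hab) h4, zero_le_one, le_rfl]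

lemma pow_mul_sub_le_one (hf : IsExpandingLorenzOn f c 0 1) {lam : ℝ} (hlam : 1 < lam)
    (hexp : ∀ x y, 0 ≤ x → x ≤ y → y ≤ 1 → c ∉ Icc x y → lam * (y - x) ≤ f y - f x)
    {a b : ℝ} {n : ℕ} (ha : 0 ≤ a) (hab : a ≤ b) (hb : b ≤ 1)
    (h : ∀ y ∈ Icc a b, ∀ i < n, f^[i] y ≠ c) : lam ^ n * (b - a) ≤ 1 := by
  induction n generalizing a b with
  | zero => simp; linarith
  | succ n ih =>
    obtain ⟨hc, h1, h2⟩ := hf.avoids_image ha hab hb h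
    calc lam ^ (n + 1) * (b - a) = lam ^ n * (lam * (b - a)) := by ring
      _ ≤ lam ^ n * (f b - f a) := by
        have := hexp a b ha hab hb hc
        gcongr
      _ ≤ 1 := ih (hf.mapsTo ⟨ha, hab.trans hb⟩).1 h1 (hf.mapsTo ⟨ha.trans hab, hb⟩).2 h2

lemma exists_iterate_eq_crit (hf : IsExpandingLorenzOn f c 0 1) {a b : ℝ} (ha : 0 ≤ a)
    (hab : a < b) (hb : b ≤ 1) : ∃ i, ∃ z ∈ Icc a b, f^[i] z = c := by
  obtain ⟨lam, hlam, hexp⟩ := hf.exists_expansion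
  by_contra! h
  obtain ⟨n, hn⟩ := pow_unbounded_of_one_lt (1 / (b - a)) hlam
  rw [div_lt_iff₀ (sub_pos.2 hab)] at hn
  exact hn.not_ge (hf.pow_mul_sub_le_one hlam hexp ha hab.le hb fun y hy i _ => h i y hy)

/-- The lift of an iterate only has downward jumps, as long as `[f 0, f 1]` has not yet
reached the critical point. -/
lemma eventually_liftIter_lt (hf : IsExpandingLorenzOn f c 0 1) {m : ℕ}
    (hm : ∀ y ∈ Icc (f 0) (f 1), ∀ i < m, f^[i] y ≠ c) {n : ℕ} (hn : n ≤ m + 2) {x ε : ℝ}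
    (hx : x ∈ Ioo (0 : ℝ) 1) (hε : 0 < ε) :
    ∀ᶠ y in 𝓝[>] x, liftIter f c n y < liftIter f c n x + ε := by
  have h01 := hf.map_zero_lt_map_one
  induction n generalizing x with
  | zero =>
    filter_upwards [Ioo_mem_nhdsGT (show x < x + ε by linarith)] with y hy
    exact hy.2
  | succ n ih =>
    by_cases hxc : x = c
    · subst hxc
      have key : ∀ᶠ y in 𝓝[>] (0 : ℝ), liftIter f x n y + 1 < liftIter f x n 1 + ε := by
        rcases n with _ | n
        · filter_upwards [Ioo_mem_nhdsGT hε] with y hy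
          simpa [liftIter, add_comm] using hy.2
        · filter_upwards [(hf.tendsto_right ⟨le_rfl, zero_lt_one⟩ hf.a_lt_c.ne).eventually
            (Ioo_mem_nhdsGT h01), Ioo_mem_nhdsGT hf.a_lt_c] with y hy hy'
          have := hf.liftIter_le (n := n) ((hf.mapsTo ⟨le_rfl, zero_le_one⟩).1.trans hy.1.le)
            hy.2.le (hf.mapsTo ⟨zero_le_one, le_rfl⟩).2
            fun t ht i hi => hm t ⟨hy.1.le.trans ht.1, ht.2⟩ i (by omega)
          simp only [liftIter, leftExt_of_ne hy'.2.ne, leftExt_of_ne hf.c_lt_b.ne',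
            if_neg hy'.2.not_gt, if_pos hf.c_lt_b]
          linarith
      filter_upwards [hf.tendsto_right_crit.eventually key, self_mem_nhdsWithin] with y hy hy'
      have hy' : x < y := hy'
      simpa [liftIter, leftExt_self, leftExt_of_ne hy'.ne', hy'] using hy
    · have hfx : f x ∈ Ioo (0 : ℝ) 1 :=
        ⟨hf.map_pos ⟨hx.1, hx.2.le⟩ hxc, hf.map_lt_one ⟨hx.1.le, hx.2⟩ hxc⟩
      have e : ∀ᶠ y in 𝓝[>] x, (y ≠ c ∧ (c < y ↔ c < x)) := by
        rcases lt_or_gt_of_ne hxc with h | h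
        · filter_upwards [Ioo_mem_nhdsGT h] with y hy
          exact ⟨hy.2.ne, iff_of_false hy.2.not_gt h.not_gt⟩
        · filter_upwards [self_mem_nhdsWithin] with y hy
          have hy : x < y := hy
          exact ⟨(h.trans hy).ne', iff_of_true (h.trans hy) h⟩
      filter_upwards [e, (hf.tendsto_right ⟨hx.1.le, hx.2⟩ hxc).eventually
        (ih (by omega) hfx)] with y hy hy'
      simp only [liftIter, leftExt_of_ne hy.1, leftExt_of_ne hxc, hy.2]
      linarith

lemma exists_left_preimage (hf : IsExpandingLorenzOn f c 0 1) {z : ℝ} (h0 : f 0 < z)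
    (h1 : z < 1) : ∃ x ∈ Ioo 0 c, f x = z := by
  obtain ⟨b, hb, hbc⟩ := ((hf.lim_left.eventually (lt_mem_nhds h1)).and
    (Ioo_mem_nhdsLT hf.a_lt_c)).exists
  obtain ⟨x, hx, rfl⟩ := intermediate_value_Icc hbc.1.le
    (hf.cont_left.mono fun t ht => ⟨ht.1, ht.2.trans_lt hbc.2⟩) ⟨h0.le, hb.le⟩
  exact ⟨x, ⟨hx.1.lt_of_ne fun e => by simp [← e] at h0, hx.2.trans_lt hbc.2⟩, rfl⟩

lemma exists_right_preimage (hf : IsExpandingLorenzOn f c 0 1) {z : ℝ} (h0 : 0 < z)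
    (h1 : z < f 1) : ∃ x ∈ Ioo c 1, f x = z := by
  obtain ⟨b, hb, hbc⟩ := ((hf.lim_right.eventually (gt_mem_nhds h0)).and
    (Ioo_mem_nhdsGT hf.c_lt_b)).exists
  obtain ⟨x, hx, rfl⟩ := intermediate_value_Icc hbc.2.le
    (hf.cont_right.mono fun t ht => ⟨hbc.1.trans_le ht.1, ht.2⟩) ⟨hb.le, h1.le⟩
  exact ⟨x, ⟨hbc.1.trans_le hx.1, hx.2.lt_of_ne fun e => by simp [e] at h1⟩, rfl⟩

end IsExpandingLorenzOn

/-- An intermediate value theorem for left-continuous functions with only downward jumps. -/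
lemma exists_eq_zero_of_downward_jumps {φ : ℝ → ℝ} {a b : ℝ} (hab : a ≤ b) (ha : φ a ≤ 0)
    (hb : 0 < φ b) (hl : ∀ x ∈ Ioc a b, Tendsto φ (𝓝[<] x) (𝓝 (φ x)))
    (hr : ∀ x ∈ Ico a b, φ x < 0 → ∀ᶠ y in 𝓝[>] x, φ y < 0) : ∃ x ∈ Ico a b, φ x = 0 := by
  set S := {x | x ∈ Icc a b ∧ φ x ≤ 0} with hS
  have haS : a ∈ S := ⟨⟨le_rfl, hab⟩, ha⟩
  have hlub : IsLUB S (sSup S) := isLUB_csSup ⟨a, haS⟩ ⟨b, fun x hx => hx.1.2⟩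
  set s := sSup S
  have has : a ≤ s := hlub.1 haS
  have hsb : s ≤ b := hlub.2 fun x hx => hx.1.2
  have hs : φ s ≤ 0 := by
    by_contra! h
    have has' : a < s := has.lt_of_ne fun e => by rw [← e] at h; linarith
    have h1 := (hl s ⟨has', hsb⟩).eventually (lt_mem_nhds h)
    obtain ⟨l, hls, hl'⟩ := (mem_nhdsLT_iff_exists_Ioo_subset' has').1 h1
    obtain ⟨t, ht, hlt, hts⟩ := hlub.exists_between hls
    rcases hts.eq_or_lt with rfl | hts
    · exact ht.2.not_gt h
    · exact ht.2.not_gt (hl' ⟨hlt, hts⟩)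
  have hsb' : s < b := hsb.lt_of_ne fun e => by rw [e] at hs; linarith
  refine ⟨s, ⟨has, hsb'⟩, hs.antisymm ?_⟩
  by_contra! h
  obtain ⟨y, hy, hy'⟩ := ((hr s ⟨has, hsb'⟩ h).and (Ioo_mem_nhdsGT hsb')).exists
  exact (hlub.1 (show y ∈ S from ⟨⟨has.trans hy'.1.le, hy'.2.le⟩, hy.le⟩)).not_gt hy'.1

/-- If `c` is first reached from `[f 0, f 1]` at time `m`, then `f^[m+2]` has a fixed point
up to one-sided limits. -/
lemma IsExpandingLorenzOn.exists_fixed_point {f : ℝ → ℝ} {c : ℝ}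
    (hf : IsExpandingLorenzOn f c 0 1) {m : ℕ}
    (hm : ∀ y ∈ Icc (f 0) (f 1), ∀ i < m, f^[i] y ≠ c) {z : ℝ} (hz : z ∈ Icc (f 0) (f 1))
    (hzc : f^[m] z = c) :
    ∃ x ∈ Ioo (0 : ℝ) 1, Tendsto f^[m + 2] (𝓝[<] x) (𝓝 x) ∨
      Tendsto f^[m + 2] (𝓝[>] x) (𝓝 x) := by
  have h01 := hf.map_zero_lt_map_one
  have hf0 := hf.mapsTo (show (0 : ℝ) ∈ Icc 0 1 from ⟨le_rfl, zero_le_one⟩)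
  have hf1 := hf.mapsTo (show (1 : ℝ) ∈ Icc 0 1 from ⟨zero_le_one, le_rfl⟩)
  have hc : c ∈ Ioo (0 : ℝ) 1 := ⟨hf.a_lt_c, hf.c_lt_b⟩
  rcases hz.1.eq_or_lt with rfl | hz0
  · refine ⟨c, hc, Or.inr ?_⟩
    have h2 := hf.tendsto_iterate_right ⟨hf0.1, h01.trans_le hf1.2⟩ m (hm _ hz)
    rw [hzc] at h2
    exact ((h2.comp (hf.tendsto_right ⟨le_rfl, zero_lt_one⟩ hc.1.ne)).comp
      hf.tendsto_right_crit).mono_right nhdsWithin_le_nhds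
  rcases hz.2.eq_or_lt with rfl | hz1
  · refine ⟨c, hc, Or.inl ?_⟩
    have h2 := hf.tendsto_iterate_left ⟨hc.1, hc.2.le⟩ (m + 2)
    rw [iterate_succ_apply, iterate_succ_apply, leftExt_self, leftExt_of_ne hc.2.ne',
      leftExt_iterate_eq _ _ (hm _ hz), hzc] at h2
    exact h2.mono_right nhdsWithin_le_nhds
  obtain ⟨a, ha, haz⟩ := hf.exists_left_preimage hz0 (hz1.trans_le hf1.2)
  obtain ⟨b, hb, hbz⟩ := hf.exists_right_preimage (hf0.1.trans_lt hz0) hz1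
  obtain ⟨k, hk⟩ := liftIter_eq_add_int f c (m + 1) z
  rw [iterate_succ_apply', leftExt_iterate_eq _ _ (hm _ hz), hzc, leftExt_self] at hk
  obtain ⟨s, hs, hs0⟩ := exists_eq_zero_of_downward_jumps
    (φ := fun x => liftIter f c (m + 2) x - x - (1 + k)) (ha.2.trans hb.1).le
    (by simp only [liftIter] at hk ⊢
        simp only [leftExt_of_ne ha.2.ne, if_neg ha.2.not_gt, haz, hk]
        linarith [ha.1])
    (by simp only [liftIter] at hk ⊢
        simp only [leftExt_of_ne hb.1.ne', if_pos hb.1, hbz, hk]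
        linarith [hb.2])
    (fun x hx => ((hf.tendsto_liftIter_left ⟨ha.1.trans hx.1, hx.2.trans hb.2.le⟩ _).sub
      nhdsWithin_le_nhds).sub_const _)
    (fun x hx hφ => by
      filter_upwards [hf.eventually_liftIter_lt hm le_rfl
        ⟨ha.1.trans_le hx.1, hx.2.trans hb.2⟩ (neg_pos.2 hφ), self_mem_nhdsWithin] with y hy hy'
      have hy' : x < y := hy'
      linarith)
  have hsI : s ∈ Ioo (0 : ℝ) 1 := ⟨ha.1.trans_le hs.1, hs.2.trans hb.2⟩
  refine ⟨s, hsI, Or.inl ?_⟩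
  have hlim := hf.tendsto_iterate_left ⟨hsI.1, hsI.2.le⟩ (m + 2)
  have hmem := hf.leftExt_iterate_mem ⟨hsI.1, hsI.2.le⟩ (m + 2)
  obtain ⟨l, hl⟩ := liftIter_eq_add_int f c (m + 2) s
  have hfix : (leftExt f c)^[m + 2] s = s := by
    simp only [hl] at hs0
    have e : (leftExt f c)^[m + 2] s - s = ((1 + k - l : ℤ) : ℝ) := by push_cast; linarith
    have h1 : ((1 + k - l : ℤ) : ℝ) < ((1 : ℤ) : ℝ) := by
      rw [← e]; push_cast; linarith [hmem.2, hsI.1]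
    have h2 : ((-1 : ℤ) : ℝ) < ((1 + k - l : ℤ) : ℝ) := by
      rw [← e]; push_cast; linarith [hmem.1, hsI.2]
    have h3 : 1 + k - l = 0 := by
      have := Int.cast_lt.1 h1
      have := Int.cast_lt.1 h2
      omega
    rw [h3] at e
    simpa [sub_eq_zero] using e
  rw [hfix] at hlim
  exact hlim.mono_right nhdsWithin_le_nhds

/-- `f 0 < f 1`, the first time `m` at which `[f 0, f 1]` contains a
`c`-free preimage of `c` is well defined, and `f^[m+2]` has a fixed point, possibly
in the one-sided-limit sense. -/
theorem iterate_has_fixed_point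
    (f : ℝ → ℝ) (c : ℝ) (hf : IsExpandingLorenz f c) :
    f 0 < f 1 ∧
    {i : ℕ | ∃ z ∈ Set.Icc (f 0) (f 1), (∀ j < i, f^[j] z ≠ c) ∧ f^[i] z = c}.Nonempty ∧
    ∃ x ∈ Set.Ioo (0:ℝ) 1,
      f^[sInf {i : ℕ | ∃ z ∈ Set.Icc (f 0) (f 1),
          (∀ j < i, f^[j] z ≠ c) ∧ f^[i] z = c} + 2] x = x ∨
      Filter.Tendsto (f^[sInf {i : ℕ | ∃ z ∈ Set.Icc (f 0) (f 1),
          (∀ j < i, f^[j] z ≠ c) ∧ f^[i] z = c} + 2])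
        (nhdsWithin x (Set.Iio x)) (nhds x) ∨
      Filter.Tendsto (f^[sInf {i : ℕ | ∃ z ∈ Set.Icc (f 0) (f 1),
          (∀ j < i, f^[j] z ≠ c) ∧ f^[i] z = c} + 2])
        (nhdsWithin x (Set.Ioi x)) (nhds x) := by
  have hf : IsExpandingLorenzOn f c 0 1 := hf
  have h01 := hf.map_zero_lt_map_one
  set S := {i : ℕ | ∃ z ∈ Set.Icc (f 0) (f 1), (∀ j < i, f^[j] z ≠ c) ∧ f^[i] z = c} with hS
  have first : ∀ z ∈ Icc (f 0) (f 1), ∀ i, f^[i] z = c → ∃ j ≤ i, j ∈ S := by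
    classical
    intro z hz i hi
    have hex : ∃ i, f^[i] z = c := ⟨i, hi⟩
    exact ⟨Nat.find hex, Nat.find_min' hex hi, z, hz, fun j hj => Nat.find_min hex hj,
      Nat.find_spec hex⟩
  have hne : S.Nonempty := by
    obtain ⟨i, z, hz, hi⟩ := hf.exists_iterate_eq_crit
      (hf.mapsTo ⟨le_rfl, zero_le_one⟩).1 h01 (hf.mapsTo ⟨zero_le_one, le_rfl⟩).2
    obtain ⟨j, -, hj⟩ := first z hz i hi
    exact ⟨j, hj⟩
  refine ⟨h01, hne, ?_⟩
  obtain ⟨z, hz, -, hzc⟩ := Nat.sInf_mem hne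
  obtain ⟨x, hx, h⟩ := hf.exists_fixed_point (m := sInf S) (fun y hy i hi hyc => by
    obtain ⟨j, hji, hj⟩ := first y hy i hyc
    exact (Nat.sInf_le hj).not_gt (hji.trans_lt hi)) hz hzc
  exact ⟨x, hx, Or.inr h⟩
end
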